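/- Let (Ω, ℱ, P) be a probability space, K and L positive integers, ỹ : Ω → EuclideanSpace ℝ (Fin L) measurable with every component ỹ_l(ω) ∈ [0,1], a : Ω → Fin K measurable, and y : Ω → Finset (Fin L) measurable. Let y_adv be a nonempty Finset of Fin L such that P({a = k} ∩ {y = y_adv}) > 0 for every k ∈ Fin K. For γ > 0 set s_γ(ω) = exp(γ·(Jac(y(ω), y_adv) − 1)), and define the s_γ-SimFair violation ℓ(γ) = Σ_{k ∈ Fin K} ‖ (∫ s_γ(ω) • ỹ(ω) dP)/(∫ s_γ dP) − (∫ 1{a = k}·s_γ(ω) • ỹ(ω) dP)/(∫ 1{a = k}·s_γ dP) ‖. Then, as γ → ∞, ℓ(γ) converges to the Equalized Opportunity violation Σ_{k ∈ Fin K} ‖ (∫ 1{y = y_adv} • ỹ dP)/P(y = y_adv) − (∫ 1{a = k}·1{y = y_adv} • ỹ dP)/P({a = k} ∩ {y = y_adv}) ‖. -/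

import Mathlib

open MeasureTheory

/-- The Jaccard score between two finsets with nonempty union. -/
noncomputable def jaccard {α : Type*} [DecidableEq α] (A B : Finset α) : ℝ :=
  ((A ∩ B).card : ℝ) / ((A ∪ B).card : ℝ)

/-- The similarity `s_γ(A, B) = exp(γ·(Jac(A, B) − 1))`. -/
noncomputable def simil {α : Type*} [DecidableEq α] (γ : ℝ) (A B : Finset α) : ℝ :=
  Real.exp (γ * (jaccard A B - 1))

/-- The `s`-weighted fairness violation
`Σ_k ‖ (∫ s • ytil dP)/(∫ s dP) − (∫ 1{a = k}·s • ytil dP)/(∫ 1{a = k}·s dP) ‖`. -/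
noncomputable def fairViolation {Ω : Type*} [MeasurableSpace Ω] (P : Measure Ω)
    {K L : ℕ} (ytil : Ω → EuclideanSpace ℝ (Fin L)) (a : Ω → Fin K) (s : Ω → ℝ) : ℝ :=
  ∑ k : Fin K,
    ‖(∫ ω, s ω ∂P)⁻¹ • (∫ ω, s ω • ytil ω ∂P)
      - (∫ ω in {ω | a ω = k}, s ω ∂P)⁻¹ • (∫ ω in {ω | a ω = k}, s ω • ytil ω ∂P)‖

theorem jaccard_self {α : Type*} [DecidableEq α] {A : Finset α} (hA : A.Nonempty) :
    jaccard A A = 1 := by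
  have : (A.card : ℝ) ≠ 0 := by exact_mod_cast hA.card_pos.ne'
  simp [jaccard, this]

theorem jaccard_le_one {α : Type*} [DecidableEq α] (A B : Finset α) : jaccard A B ≤ 1 :=
  div_le_one_of_le₀
    (by exact_mod_cast Finset.card_le_card (Finset.inter_subset_left.trans Finset.subset_union_left))
    (by positivity)

theorem jaccard_lt_one {α : Type*} [DecidableEq α] {A B : Finset α} (h : A ≠ B) :
    jaccard A B < 1 := by
  have hss : A ∩ B ⊂ A ∪ B := by
    refine Finset.ssubset_iff_subset_ne.2
      ⟨Finset.inter_subset_left.trans Finset.subset_union_left, fun he => h ?_⟩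
    ext x
    have := congrArg (x ∈ ·) he
    simp only [Finset.mem_inter, Finset.mem_union, eq_iff_iff] at this
    tauto
  have hcard : ((A ∩ B).card : ℝ) < (A ∪ B).card := by
    exact_mod_cast Finset.card_lt_card hss
  exact (div_lt_one ((Nat.cast_nonneg _).trans_lt hcard)).2 hcard

theorem tendsto_simil_atTop {α : Type*} [DecidableEq α] (A : Finset α) {B : Finset α}
    (hB : B.Nonempty) :
    Filter.Tendsto (fun γ => simil γ A B) Filter.atTop (nhds (if A = B then 1 else 0)) := by
  split_ifs with h
  · subst h
    simp [simil, jaccard_self hB]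
  · exact Real.tendsto_exp_atBot.comp
      (Filter.tendsto_id.atTop_mul_const_of_neg (sub_neg.2 (jaccard_lt_one h)))

theorem abs_simil_le_one {α : Type*} [DecidableEq α] {γ : ℝ} (hγ : 0 ≤ γ) (A B : Finset α) :
    |simil γ A B| ≤ 1 := by
  rw [simil, Real.abs_exp, Real.exp_le_one_iff]
  exact mul_nonpos_of_nonneg_of_nonpos hγ (sub_nonpos.2 (jaccard_le_one A B))

theorem measurable_simil_comp {Ω α : Type*} [MeasurableSpace Ω] [DecidableEq α] [Countable α]
    {y : Ω → Finset α} (hy : ∀ S, MeasurableSet {ω | y ω = S}) (γ : ℝ) (B : Finset α) :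
    Measurable fun ω => simil γ (y ω) B := by
  let _ : MeasurableSpace (Finset α) := ⊤
  have hy' : Measurable y := measurable_to_countable' hy
  exact (measurable_from_top (f := fun A => simil γ A B)).comp hy'

/-- As `γ → ∞`, weighting by the similarity to `B` amounts to restricting to `{y = B}`. -/
theorem tendsto_integral_simil_smul {Ω α E : Type*} [MeasurableSpace Ω] [DecidableEq α]
    [Countable α] [NormedAddCommGroup E] [NormedSpace ℝ E] {μ : Measure Ω}
    {y : Ω → Finset α} (hy : ∀ S, MeasurableSet {ω | y ω = S}) {B : Finset α}
    (hB : B.Nonempty) {f : Ω → E} (hf : Integrable f μ) :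
    Filter.Tendsto (fun γ => ∫ ω, simil γ (y ω) B • f ω ∂μ) Filter.atTop
      (nhds (∫ ω in {ω | y ω = B}, f ω ∂μ)) := by
  rw [← integral_indicator (hy B)]
  refine tendsto_integral_filter_of_dominated_convergence (fun ω => ‖f ω‖) ?_ ?_ hf.norm ?_
  · exact .of_forall fun γ =>
      (measurable_simil_comp hy γ B).aestronglyMeasurable.smul hf.aestronglyMeasurable
  · filter_upwards [Filter.eventually_ge_atTop 0] with γ hγ
    refine .of_forall fun ω => ?_
    rw [norm_smul, Real.norm_eq_abs]
    exact mul_le_of_le_one_left (norm_nonneg _) (abs_simil_le_one hγ _ _)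
  · refine .of_forall fun ω => ?_
    convert (tendsto_simil_atTop (y ω) hB).smul_const (f ω) using 2
    by_cases h : y ω = B <;> simp [h]

/-- The similarity-weighted mean converges to the mean conditional on `{y = B}`. -/
theorem tendsto_simil_weighted_mean {Ω α E : Type*} [MeasurableSpace Ω] [DecidableEq α]
    [Countable α] [NormedAddCommGroup E] [NormedSpace ℝ E] {μ : Measure Ω} [IsFiniteMeasure μ]
    {y : Ω → Finset α} (hy : ∀ S, MeasurableSet {ω | y ω = S}) {B : Finset α}
    (hB : B.Nonempty) (hμ : μ {ω | y ω = B} ≠ 0) {f : Ω → E} (hf : Integrable f μ) :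
    Filter.Tendsto
      (fun γ => (∫ ω, simil γ (y ω) B ∂μ)⁻¹ • ∫ ω, simil γ (y ω) B • f ω ∂μ) Filter.atTop
      (nhds ((μ {ω | y ω = B}).toReal⁻¹ • ∫ ω in {ω | y ω = B}, f ω ∂μ)) := by
  have hden : Filter.Tendsto (fun γ => ∫ ω, simil γ (y ω) B ∂μ) Filter.atTop
      (nhds (μ {ω | y ω = B}).toReal) := by
    simpa [Measure.real] using
      tendsto_integral_simil_smul hy hB (integrable_const (μ := μ) (1 : ℝ))
  exact (hden.inv₀ (ENNReal.toReal_ne_zero.2 ⟨hμ, measure_ne_top _ _⟩)).smul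
    (tendsto_integral_simil_smul hy hB hf)

theorem EuclideanSpace.norm_le_sqrt_card {ι : Type*} [Fintype ι] {x : EuclideanSpace ℝ ι}
    (hx : ∀ i, x i ∈ Set.Icc (0 : ℝ) 1) : ‖x‖ ≤ √(Fintype.card ι) := by
  rw [EuclideanSpace.norm_eq]
  refine Real.sqrt_le_sqrt ((Finset.sum_le_card_nsmul _ _ 1 fun i _ => ?_).trans_eq (by simp))
  rw [Real.norm_of_nonneg (hx i).1]
  exact pow_le_one₀ (hx i).1 (hx i).2

/-- EOp direction of Proposition 3: the `s_γ`-SimFair violation converges, as `γ → ∞`,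
to the Equalized Opportunity violation. -/
theorem stmt8 {Ω : Type*} [MeasurableSpace Ω]
    (P : Measure Ω) [IsProbabilityMeasure P]
    (K L : ℕ) (hK : 0 < K) (hL : 0 < L)
    (ytil : Ω → EuclideanSpace ℝ (Fin L)) (hmeas : Measurable ytil)
    (hbd : ∀ ω l, ytil ω l ∈ Set.Icc (0 : ℝ) 1)
    (a : Ω → Fin K) (ha : Measurable a)
    (y : Ω → Finset (Fin L)) (hy : ∀ S : Finset (Fin L), MeasurableSet {ω | y ω = S})
    (yadv : Finset (Fin L)) (hyadv : yadv.Nonempty)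
    (hpos : ∀ k : Fin K, 0 < P ({ω | a ω = k} ∩ {ω | y ω = yadv})) :
    Filter.Tendsto
      (fun γ : ℝ => fairViolation P ytil a (fun ω => simil γ (y ω) yadv))
      Filter.atTop
      (nhds (∑ k : Fin K,
        ‖(P {ω | y ω = yadv}).toReal⁻¹ • (∫ ω in {ω | y ω = yadv}, ytil ω ∂P)
          - (P ({ω | a ω = k} ∩ {ω | y ω = yadv})).toReal⁻¹ •
              (∫ ω in {ω | a ω = k} ∩ {ω | y ω = yadv}, ytil ω ∂P)‖)) := by
  have hint : Integrable ytil P := .of_bound hmeas.aestronglyMeasurable _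
    (.of_forall fun ω => EuclideanSpace.norm_le_sqrt_card (hbd ω))
  refine tendsto_finsetSum _ fun k _ => (Filter.Tendsto.sub ?_ ?_).norm
  · exact tendsto_simil_weighted_mean hy hyadv
      (((hpos k).trans_le (measure_mono Set.inter_subset_right)).ne') hint
  · have hr : P.restrict {ω | a ω = k} {ω | y ω = yadv}
        = P ({ω | a ω = k} ∩ {ω | y ω = yadv}) := by
      rw [Measure.restrict_apply (hy yadv), Set.inter_comm]
    have h := tendsto_simil_weighted_mean (μ := P.restrict {ω | a ω = k}) hy hyadv
      (hr ▸ (hpos k).ne') hint.restrict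
    rwa [hr, Measure.restrict_restrict (hy yadv), Set.inter_comm {ω | y ω = yadv}] at h
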